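/- There exist an integer k₀ and a positive constant c such that for any fixed k ≥ k₀ and fixed r ≥ 2: if p = p(n) ≤ c · (r^{k−1}/k²) · n/C(n,k), then P(H(n,k,p) is r-choosable) → 1 as n → ∞. -/

import Mathlib

open Finset Filter

open scoped Classical

namespace HG

/-- A finset `e` is monochromatic under the coloring `c`. -/
def Monochromatic {V α : Type*} (c : V → α) (e : Finset V) : Prop :=
  ∀ v ∈ e, ∀ w ∈ e, c v = c w

/-- The hypergraph with edge set `E` admits a proper coloring with `r` colors. -/
def RColorable {V : Type*} (r : ℕ) (E : Finset (Finset V)) : Prop :=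
  ∃ c : V → Fin r, ∀ e ∈ E, ¬ Monochromatic c e

/-- The hypergraph with edge set `E` is `r`-choosable: for every assignment of
color lists of size `r` there is a proper coloring from the lists. -/
def RChoosable {V : Type*} (r : ℕ) (E : Finset (Finset V)) : Prop :=
  ∀ L : V → Finset ℕ, (∀ v, (L v).card = r) →
    ∃ c : V → ℕ, (∀ v, c v ∈ L v) ∧ ∀ e ∈ E, ¬ Monochromatic c e

/-- Probability that the binomial random hypergraph `H(n,k,p)` (each of the
`C(n,k)` possible `k`-element edges present independently with probability `p`)
satisfies the property `P` of its edge set. -/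
noncomputable def hyperProb (n k : ℕ) (p : ℝ)
    (P : Finset (Finset (Fin n)) → Prop) : ℝ :=
  ∑ E ∈ ((Finset.univ : Finset (Fin n)).powersetCard k).powerset,
    if P E then
      p ^ E.card *
        (1 - p) ^ (((Finset.univ : Finset (Fin n)).powersetCard k).card - E.card)
    else 0

/-- Maximum vertex degree of the hypergraph with edge set `E`. -/
def maxDegree {V : Type*} [DecidableEq V] (E : Finset (Finset V)) : ℕ :=
  (E.biUnion id).sup fun v => (E.filter fun e => v ∈ e).card

/-- Three distinct edges forming a 3-cycle (triangle). -/
def IsTriangle {V : Type*} [DecidableEq V] (e f h : Finset V) : Prop :=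
  e ≠ f ∧ e ≠ h ∧ f ≠ h ∧ ((e ∩ f) \ h).Nonempty ∧ ((e ∩ h) \ f).Nonempty ∧
    ((f ∩ h) \ e).Nonempty

/-- A hypergraph is 2-simple if any two distinct edges share at most 2 vertices. -/
def TwoSimple {V : Type*} [DecidableEq V] (E : Finset (Finset V)) : Prop :=
  ∀ e ∈ E, ∀ f ∈ E, e ≠ f → (e ∩ f).card ≤ 2

/-- The number of 3-cycles of the hypergraph `E` containing the edge `e`. -/
noncomputable def triCount {V : Type*} [DecidableEq V]
    (E : Finset (Finset V)) (e : Finset V) : ℕ :=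
  ((E.powersetCard 2).filter fun s =>
    ∃ f ∈ s, ∃ h ∈ s, f ≠ h ∧ IsTriangle e f h).card

/-- The function `φ(k) = 4⌊√(ln k / ln (2 ln k))⌋⁻¹`. -/
noncomputable def phi (k : ℕ) : ℝ :=
  4 * ((⌊Real.sqrt (Real.log k / Real.log (2 * Real.log k))⌋₊ : ℝ))⁻¹

end HG

namespace HG

/-- Colorings from the lists `L` on `X`, equal to `c₀` off `X`, with no monochromatic edge
inside `X ∪ W`. -/
noncomputable def extensions {V : Type*} [Fintype V] [DecidableEq V] (E : Finset (Finset V))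
    (W : Finset V) (L : V → Finset ℕ) (c₀ : V → ℕ) (X : Finset V) : Finset (V → ℕ) :=
  (Fintype.piFinset fun v => if v ∈ X then L v else {c₀ v}).filter
    fun c => ∀ e ∈ E, e ⊆ X ∪ W → ¬ Monochromatic c e

lemma mem_extensions {V : Type*} [Fintype V] [DecidableEq V] {E : Finset (Finset V)}
    {W : Finset V} {L : V → Finset ℕ} {c₀ : V → ℕ} {X : Finset V} {c : V → ℕ} :
    c ∈ extensions E W L c₀ X ↔ (∀ v ∈ X, c v ∈ L v) ∧ (∀ v, v ∉ X → c v = c₀ v) ∧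
      ∀ e ∈ E, e ⊆ X ∪ W → ¬ Monochromatic c e := by
  simp only [extensions, Finset.mem_filter, Fintype.mem_piFinset, ← and_assoc]
  refine and_congr_left fun _ => ⟨fun h => ⟨fun v hv => ?_, fun v hv => ?_⟩, fun h v => ?_⟩
  · simpa [hv] using h v
  · simpa [hv] using h v
  · by_cases hv : v ∈ X
    · simpa [hv] using h.1 v hv
    · simpa [hv] using h.2 v hv

lemma Monochromatic.mono {V α : Type*} {c : V → α} {e f : Finset V} (h : Monochromatic c f)
    (hef : e ⊆ f) : Monochromatic c e :=
  fun v hv w hw => h v (hef hv) w (hef hw)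

/-- Extensions of a coloring of `X` to `v` which make the edge `e` monochromatic are determined
by their restriction to the complement of `T ∪ {v}`. -/
lemma card_bad_le {V : Type*} [Fintype V] [DecidableEq V] {E : Finset (Finset V)}
    {W : Finset V} {L : V → Finset ℕ} {c₀ : V → ℕ} {X : Finset V} {v u : V} {e T : Finset V}
    (hve : v ∈ e) (hTe : T ⊆ e) (hTW : Disjoint T W) (hvT : v ∉ T)
    (hue : u ∈ e) (huv : u ≠ v) (huT : u ∉ T) :
    ((extensions E W L c₀ X ×ˢ L v).filter
      fun x => Monochromatic (Function.update x.1 v x.2) e).card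
      ≤ (extensions E W L c₀ (X \ T)).card := by
  refine Finset.card_le_card_of_injOn (fun x w => if w ∈ T then c₀ w else x.1 w) ?_ ?_
  · rintro ⟨c, a⟩ hx
    simp only [Finset.coe_filter, Finset.mem_product, Set.mem_ofPred_eq] at hx
    obtain ⟨⟨hc, ha⟩, hm⟩ := hx
    rw [mem_extensions] at hc
    simp only [Finset.mem_coe, mem_extensions]
    refine ⟨fun w hw => ?_, fun w hw => ?_, fun f hf hfs hmf => ?_⟩
    · rw [Finset.mem_sdiff] at hw
      simpa [hw.2] using hc.1 w hw.1
    · by_cases hwT : w ∈ T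
      · simp [hwT]
      · have : w ∉ X := fun h => hw (Finset.mem_sdiff.2 ⟨h, hwT⟩)
        simpa [hwT] using hc.2.1 w this
    · refine hc.2.2 f hf (hfs.trans (Finset.union_subset_union_left Finset.sdiff_subset)) ?_
      have hfT : ∀ w ∈ f, w ∉ T := by
        intro w hw hwT
        rcases Finset.mem_union.1 (hfs hw) with h | h
        · exact (Finset.mem_sdiff.1 h).2 hwT
        · exact Finset.disjoint_left.1 hTW hwT h
      intro w hw w' hw'
      simpa [hfT w hw, hfT w' hw'] using hmf w hw w' hw'
  · rintro ⟨c, a⟩ hx ⟨c', a'⟩ hx' heq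
    simp only [Finset.coe_filter, Finset.mem_product, Set.mem_ofPred_eq] at hx hx'
    obtain ⟨⟨hc, ha⟩, hm⟩ := hx
    obtain ⟨⟨hc', ha'⟩, hm'⟩ := hx'
    have hoff : ∀ w, w ∉ T → c w = c' w := by
      intro w hw
      simpa [hw] using congrFun heq w
    have hu := hoff u huT
    have haa : a = a' := by
      have h1 := hm v hve u hue
      have h2 := hm' v hve u hue
      simp only [Function.update_self, Function.update_of_ne huv] at h1 h2
      rw [h1, h2, hu]
    refine Prod.ext (funext fun w => ?_) haa
    by_cases hw : w ∈ T
    · have hwv : w ≠ v := fun h => hvT (h ▸ hw)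
      have h1 := hm w (hTe hw) u hue
      have h2 := hm' w (hTe hw) u hue
      simp only [Function.update_of_ne hwv, Function.update_of_ne huv] at h1 h2
      simp only [h1, h2, hu]
    · exact hoff w hw

/-- The counting step: adding one vertex multiplies the number of proper colorings
by at least `β`. -/
lemma mul_card_extensions_le {V : Type*} [Fintype V] [DecidableEq V] {E F : Finset (Finset V)}
    {W : Finset V} {L : V → Finset ℕ} {c₀ : V → ℕ} {r : ℕ} {β : ℝ} (hβ : 0 < β)
    (hL : ∀ v, (L v).card = r) (T : V → Finset V → Finset V)
    (hdead : ∀ e ∈ E, e ∉ F → ¬ Monochromatic c₀ (e ∩ W))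
    (hT : ∀ e ∈ F, ∀ v ∈ e, v ∉ W → T v e ⊆ e ∧ Disjoint (T v e) W ∧ v ∉ T v e ∧
      ∃ u ∈ e, u ≠ v ∧ u ∉ T v e)
    (hsum : ∀ v, v ∉ W → ∑ e ∈ F with v ∈ e, (β ^ (T v e).card)⁻¹ ≤ r - β) :
    ∀ (m : ℕ) (X : Finset V), X.card = m → Disjoint X W → ∀ v, v ∉ X → v ∉ W →
      β * (extensions E W L c₀ X).card ≤ (extensions E W L c₀ (insert v X)).card := by
  intro m
  induction m using Nat.strong_induction_on with
  | _ m ih =>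
  intro X hXm hXW v hvX hvW
  have hpow : ∀ S : Finset V, S ⊆ X → β ^ S.card * (extensions E W L c₀ (X \ S)).card
      ≤ (extensions E W L c₀ X).card := by
    intro S
    induction S using Finset.induction_on with
    | empty => simp
    | insert a S haS ihS =>
      intro hS
      have haX : a ∈ X := hS (Finset.mem_insert_self _ _)
      have hSX : S ⊆ X := (Finset.subset_insert _ _).trans hS
      have hlt : (X \ insert a S).card < m := by
        rw [← hXm]
        refine Finset.card_lt_card (Finset.ssubset_iff_of_subset Finset.sdiff_subset |>.2
          ⟨a, haX, by simp⟩)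
      have h1 := ih _ hlt (X \ insert a S) rfl (hXW.mono_left Finset.sdiff_subset) a (by simp)
        (Finset.disjoint_left.1 hXW haX)
      have h2 : insert a (X \ insert a S) = X \ S := by
        ext w
        simp only [Finset.mem_insert, Finset.mem_sdiff]
        constructor
        · rintro (rfl | h)
          · exact ⟨haX, haS⟩
          · exact ⟨h.1, fun h' => h.2 (Or.inr h')⟩
        · rintro ⟨h, h'⟩
          by_cases hw : w = a
          · exact Or.inl hw
          · exact Or.inr ⟨h, by simp [hw, h']⟩
      rw [h2] at h1
      rw [Finset.card_insert_of_notMem haS, pow_succ, mul_assoc]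
      exact (mul_le_mul_of_nonneg_left h1 (by positivity)).trans (ihS hSX)
  set N := extensions E W L c₀ X with hN
  set bad : Finset V → Finset ((V → ℕ) × ℕ) := fun e =>
    (N ×ˢ L v).filter fun x => Monochromatic (Function.update x.1 v x.2) e with hbad
  set live := (F.filter fun e => v ∈ e).filter fun e => e ⊆ insert v X ∪ W with hlive
  have hcover : (N ×ˢ L v).card ≤ (extensions E W L c₀ (insert v X)).card
      + ∑ e ∈ live, (bad e).card := by
    set good := (N ×ˢ L v).filter
      fun x => Function.update x.1 v x.2 ∈ extensions E W L c₀ (insert v X) with hgood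
    have hsub : N ×ˢ L v ⊆ good ∪ live.biUnion bad := by
      rintro ⟨c, a⟩ hx
      rw [Finset.mem_union]
      by_contra hcon
      push Not at hcon
      obtain ⟨hg, hb⟩ := hcon
      refine hg (Finset.mem_filter.2 ⟨hx, ?_⟩)
      obtain ⟨hc, ha⟩ := Finset.mem_product.1 hx
      simp only at hc ha
      rw [hN, mem_extensions] at hc
      rw [mem_extensions]
      refine ⟨fun w hw => ?_, fun w hw => ?_, fun e he hes hm => ?_⟩
      · by_cases hwv : w = v
        · subst hwv; simpa using ha
        · simpa [hwv] using hc.1 w ((Finset.mem_insert.1 hw).resolve_left hwv)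
      · rw [Finset.mem_insert, not_or] at hw
        simpa [hw.1] using hc.2.1 w hw.2
      · by_cases hve : v ∈ e
        · by_cases heF : e ∈ F
          · refine hb (Finset.mem_biUnion.2 ⟨e, ?_, ?_⟩)
            · simp only [hlive, Finset.mem_filter]
              exact ⟨⟨heF, hve⟩, hes⟩
            · exact Finset.mem_filter.2 ⟨hx, hm⟩
          · refine hdead e he heF fun x hx y hy => ?_
            rw [Finset.mem_inter] at hx hy
            have hxv : x ≠ v := fun h => hvW (h ▸ hx.2)
            have hyv : y ≠ v := fun h => hvW (h ▸ hy.2)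
            have := hm x hx.1 y hy.1
            simp only [Function.update_of_ne hxv, Function.update_of_ne hyv] at this
            rwa [hc.2.1 x fun h => Finset.disjoint_left.1 hXW h hx.2,
              hc.2.1 y fun h => Finset.disjoint_left.1 hXW h hy.2] at this
        · refine hc.2.2 e he (fun w hw => ?_) fun x hx y hy => ?_
          · have := hes hw
            rw [Finset.insert_union, Finset.mem_insert] at this
            exact this.resolve_left fun h => hve (h ▸ hw)
          · have hxv : x ≠ v := fun h => hve (h ▸ hx)
            have hyv : y ≠ v := fun h => hve (h ▸ hy)
            simpa [hxv, hyv] using hm x hx y hy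
    have hgc : good.card ≤ (extensions E W L c₀ (insert v X)).card := by
      refine Finset.card_le_card_of_injOn (fun x => Function.update x.1 v x.2) ?_ ?_
      · intro x hx
        exact (Finset.mem_filter.1 hx).2
      · rintro ⟨c, a⟩ hx ⟨c', a'⟩ hx' heq
        simp only [hgood, Finset.coe_filter, Finset.mem_product, Set.mem_ofPred_eq] at hx hx'
        have hc := mem_extensions.1 hx.1.1
        have hc' := mem_extensions.1 hx'.1.1
        simp only at heq
        refine Prod.ext (funext fun w => ?_) ?_
        · by_cases hw : w = v
          · subst hw
            simp only [hc.2.1 w hvX, hc'.2.1 w hvX]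
          · simpa [hw] using congrFun heq w
        · simpa using congrFun heq v
    calc (N ×ˢ L v).card ≤ (good ∪ live.biUnion bad).card := Finset.card_le_card hsub
      _ ≤ good.card + (live.biUnion bad).card := Finset.card_union_le _ _
      _ ≤ _ := add_le_add hgc Finset.card_biUnion_le
  have hbadle : ∀ e ∈ live, ((bad e).card : ℝ) ≤ (β ^ (T v e).card)⁻¹ * N.card := by
    intro e he
    simp only [hlive, Finset.mem_filter] at he
    obtain ⟨⟨heF, hve⟩, hes⟩ := he
    obtain ⟨h1, h2, h3, u, hue, huv, huT⟩ := hT e heF v hve hvW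
    have hTX : T v e ⊆ X := by
      intro w hw
      have := hes (h1 hw)
      rw [Finset.mem_union, Finset.mem_insert] at this
      rcases this with (h | h) | h
      · exact absurd (h ▸ hw) h3
      · exact h
      · exact absurd h (Finset.disjoint_left.1 h2 hw)
    have hb : ((bad e).card : ℝ) ≤ (extensions E W L c₀ (X \ T v e)).card := by
      exact_mod_cast card_bad_le hve h1 h2 h3 hue huv huT
    rw [inv_mul_eq_div, le_div_iff₀ (by positivity), mul_comm]
    exact (mul_le_mul_of_nonneg_left hb (by positivity)).trans (hpow _ hTX)
  have hcover' : (N.card : ℝ) * r ≤ (extensions E W L c₀ (insert v X)).card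
      + ∑ e ∈ live, ((bad e).card : ℝ) := by
    rw [Finset.card_product, hL] at hcover
    exact_mod_cast hcover
  have hs : ∑ e ∈ live, ((bad e).card : ℝ) ≤ (r - β) * N.card := by
    calc ∑ e ∈ live, ((bad e).card : ℝ)
        ≤ ∑ e ∈ live, (β ^ (T v e).card)⁻¹ * N.card := Finset.sum_le_sum hbadle
      _ = (∑ e ∈ live, (β ^ (T v e).card)⁻¹) * N.card := by rw [Finset.sum_mul]
      _ ≤ _ := by
        refine mul_le_mul_of_nonneg_right (le_trans ?_ (hsum v hvW)) (by positivity)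
        exact Finset.sum_le_sum_of_subset_of_nonneg (Finset.filter_subset _ _)
          fun _ _ _ => by positivity
  linarith

lemma exists_coloring_of_sum_le {V : Type*} [Fintype V] [DecidableEq V]
    {E F : Finset (Finset V)}
    {W : Finset V} {L : V → Finset ℕ} {c₀ : V → ℕ} {r : ℕ} {β : ℝ} (hβ : 0 < β)
    (hL : ∀ v, (L v).card = r) (hc₀ : ∀ v, c₀ v ∈ L v) (T : V → Finset V → Finset V)
    (hdead : ∀ e ∈ E, e ∉ F → ¬ Monochromatic c₀ (e ∩ W)) (hFW : ∀ e ∈ F, ¬ e ⊆ W)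
    (hT : ∀ e ∈ F, ∀ v ∈ e, v ∉ W → T v e ⊆ e ∧ Disjoint (T v e) W ∧ v ∉ T v e ∧
      ∃ u ∈ e, u ≠ v ∧ u ∉ T v e)
    (hsum : ∀ v, v ∉ W → ∑ e ∈ F with v ∈ e, (β ^ (T v e).card)⁻¹ ≤ r - β) :
    ∃ c : V → ℕ, (∀ v, c v ∈ L v) ∧ ∀ e ∈ E, ¬ Monochromatic c e := by
  have hpos : ∀ X : Finset V, Disjoint X W → 0 < (extensions E W L c₀ X).card := by
    intro X
    induction X using Finset.induction_on with
    | empty =>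
      intro _
      refine Finset.card_pos.2 ⟨c₀, mem_extensions.2 ⟨by simp, by simp, fun e he hes hm => ?_⟩⟩
      by_cases heF : e ∈ F
      · exact hFW e heF (by simpa using hes)
      · exact hdead e he heF (hm.mono Finset.inter_subset_left)
    | insert v X hvX ih =>
      intro hd
      rw [Finset.disjoint_insert_left] at hd
      have h1 : (0 : ℝ) < (extensions E W L c₀ X).card := by exact_mod_cast ih hd.2
      have h2 := mul_card_extensions_le hβ hL T hdead hT hsum _ X rfl hd.2 v hvX hd.1
      have h3 : (0 : ℝ) < (extensions E W L c₀ (insert v X)).card :=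
        lt_of_lt_of_le (by positivity) h2
      exact_mod_cast h3
  obtain ⟨c, hc⟩ := Finset.card_pos.1 (hpos (Finset.univ \ W) Finset.sdiff_disjoint)
  rw [mem_extensions] at hc
  refine ⟨c, fun v => ?_, fun e he => hc.2.2 e he fun v _ => by simp⟩
  by_cases hv : v ∈ W
  · rw [hc.2.1 v (by simp [hv])]
    exact hc₀ v
  · exact hc.1 v (by simp [hv])

/-- If the sets `e ∩ W` satisfy a doubled Hall condition, then they can be list colored from
lists of size at least two. -/
lemma exists_coloring_of_hall {V : Type*} [DecidableEq V]
    (B : Finset (Finset V)) (W : Finset V) (L : V → Finset ℕ) (hL : ∀ v, 2 ≤ (L v).card)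
    (hall : ∀ F ⊆ B, 2 * F.card ≤ (F.biUnion fun e => e ∩ W).card) :
    ∃ c : V → ℕ, (∀ v, c v ∈ L v) ∧ ∀ e ∈ B, ¬ Monochromatic c (e ∩ W) := by
  obtain ⟨f, hf, hfm⟩ := (Finset.all_card_le_biUnion_card_iff_exists_injective
    (fun x : {e // e ∈ B} × Bool => x.1.1 ∩ W)).1 (by
      intro s
      have h1 : s ⊆ (s.image Prod.fst) ×ˢ (Finset.univ : Finset Bool) := by
        intro x hx
        simp only [Finset.mem_product, Finset.mem_univ, and_true]
        exact Finset.mem_image_of_mem _ hx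
      have h2 := Finset.card_le_card h1
      rw [Finset.card_product, Finset.card_univ, Fintype.card_bool] at h2
      have h3 := hall ((s.image Prod.fst).map (Function.Embedding.subtype _)) (by
        intro e he
        obtain ⟨x, _, rfl⟩ := Finset.mem_map.1 he
        exact x.2)
      rw [Finset.card_map] at h3
      have h4 : (((s.image Prod.fst).map (Function.Embedding.subtype _)).biUnion
          fun e => e ∩ W) ⊆ s.biUnion fun x => x.1.1 ∩ W := by
        intro v hv
        simp only [Finset.mem_biUnion, Finset.mem_map, Finset.mem_image] at hv ⊢
        obtain ⟨e, ⟨x, ⟨y, hy, rfl⟩, rfl⟩, hv⟩ := hv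
        exact ⟨y, hy, hv⟩
      have h5 := Finset.card_le_card h4
      omega)
  have hb : ∀ v, ∃ a, a ∈ L v := fun v => Finset.card_pos.1 (by have := hL v; omega)
  choose b hb using hb
  have hd : ∀ v a, ∃ a' ∈ L v, a' ≠ a := fun v a =>
    Finset.exists_mem_ne (by have := hL v; omega) a
  choose d hd hda using hd
  refine ⟨fun v => if h : ∃ e, f (e, true) = v then d v (b (f (h.choose, false))) else b v,
    fun v => ?_, fun e he hm => ?_⟩
  · dsimp only
    split_ifs
    · exact hd _ _
    · exact hb _
  · have hmono := hm (f (⟨e, he⟩, true)) (hfm (⟨e, he⟩, true))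
      (f (⟨e, he⟩, false)) (hfm (⟨e, he⟩, false))
    have h1 : ∃ e', f (e', true) = f (⟨e, he⟩, true) := ⟨_, rfl⟩
    have h2 : ¬ ∃ e', f (e', true) = f (⟨e, he⟩, false) := by
      rintro ⟨e', he'⟩
      simpa using hf he'
    have h3 : h1.choose = ⟨e, he⟩ := by
      have := hf h1.choose_spec
      simpa using this
    dsimp only at hmono
    rw [dif_pos h1, dif_neg h2, h3] at hmono
    exact hda _ _ hmono

lemma sum_degree_eq {V : Type*} [DecidableEq V] (E : Finset (Finset V)) (S : Finset V) :
    ∑ v ∈ S, (E.filter fun e => v ∈ e).card = ∑ e ∈ E, (e ∩ S).card := by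
  have := Finset.sum_card_bipartiteAbove_eq_sum_card_bipartiteBelow (s := S) (t := E)
    (fun v e => v ∈ e)
  simp only [Finset.bipartiteAbove, Finset.bipartiteBelow] at this
  rw [this]
  refine Finset.sum_congr rfl fun e _ => ?_
  rw [Finset.filter_mem_eq_inter, Finset.inter_comm]

/-- In a locally sparse hypergraph, a small set is contained in a small set `W` such that every
vertex outside `W` lies in few edges meeting `W` in at least two vertices. -/
lemma exists_closed_superset {V : Type*} [Fintype V] [DecidableEq V] {E : Finset (Finset V)}
    {k m : ℕ} (hE : ∀ e ∈ E, e.card = k)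
    (h3 : ∀ S : Finset V, S.card ≤ m → (E.filter fun e => 3 ≤ (e ∩ S).card).card ≤ S.card)
    (W₀ : Finset V) (hW₀ : 2 * W₀.card < m) :
    ∃ W, W₀ ⊆ W ∧ W.card ≤ 2 * W₀.card ∧
      ∀ v, v ∉ W → (E.filter fun e => v ∈ e ∧ 2 ≤ (e ∩ W).card).card ≤ 2 * k := by
  set g : Finset V → ℕ := fun W => ∑ e ∈ E, ((e ∩ W).card - 2) with hg
  have hgle : ∀ W : Finset V, W.card ≤ m → g W ≤ k * W.card := by
    intro W hW
    calc g W ≤ ∑ e ∈ E, if 3 ≤ (e ∩ W).card then k else 0 := by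
          refine Finset.sum_le_sum fun e he => ?_
          have : (e ∩ W).card ≤ k := hE e he ▸ Finset.card_le_card Finset.inter_subset_left
          split_ifs <;> omega
      _ = (E.filter fun e => 3 ≤ (e ∩ W).card).card * k := by
          rw [← Finset.sum_filter, Finset.sum_const, smul_eq_mul]
      _ ≤ k * W.card := by
          rw [mul_comm]
          exact Nat.mul_le_mul_left _ (h3 W hW)
  obtain ⟨W, hWmem, hmax⟩ := Finset.exists_max_image
    ((Finset.univ : Finset (Finset V)).filter fun W => W₀ ⊆ W ∧ W.card ≤ m)
    (fun W => (g W : ℤ) - 2 * k * W.card)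
    ⟨W₀, by simp only [Finset.mem_filter, Finset.mem_univ, true_and]; exact ⟨subset_rfl, by omega⟩⟩
  simp only [Finset.mem_filter, Finset.mem_univ, true_and] at hWmem hmax
  obtain ⟨hsub, hWm⟩ := hWmem
  rcases Nat.eq_zero_or_pos k with rfl | hk
  · refine ⟨W₀, subset_rfl, by omega, fun v hv => ?_⟩
    rw [Finset.card_eq_zero.2]
    · refine Finset.filter_eq_empty_iff.2 fun e he h => ?_
      rw [Finset.card_eq_zero.1 (hE e he)] at h
      simp at h
  have hcard : W.card ≤ 2 * W₀.card := by
    have h1 := hmax W₀ ⟨subset_rfl, by omega⟩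
    have h2 := hgle W hWm
    have h2' : (g W : ℤ) ≤ k * W.card := by exact_mod_cast h2
    have h4 : (0 : ℤ) ≤ g W₀ := by positivity
    have h5 : (k : ℤ) * W.card ≤ k * (2 * W₀.card) := by linarith
    have h6 : k * W.card ≤ k * (2 * W₀.card) := by exact_mod_cast h5
    exact Nat.le_of_mul_le_mul_left h6 hk
  refine ⟨W, hsub, hcard, fun v hv => ?_⟩
  have hins : (insert v W).card = W.card + 1 := Finset.card_insert_of_notMem hv
  have h1 := hmax (insert v W) ⟨hsub.trans (Finset.subset_insert _ _), by omega⟩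
  have h2 : g (insert v W) = g W + (E.filter fun e => v ∈ e ∧ 2 ≤ (e ∩ W).card).card := by
    rw [Finset.card_filter, hg]
    simp only
    rw [← Finset.sum_add_distrib]
    refine Finset.sum_congr rfl fun e _ => ?_
    by_cases hve : v ∈ e
    · rw [Finset.inter_insert_of_mem hve, Finset.card_insert_of_notMem (by simp [hv])]
      simp only [hve, true_and]
      split_ifs <;> omega
    · rw [Finset.inter_insert_of_notMem hve]
      simp [hve]
  rw [h2, hins] at h1
  push_cast at h1
  have h3 : (((E.filter fun e => v ∈ e ∧ 2 ≤ (e ∩ W).card).card : ℕ) : ℤ) ≤ 2 * k := by linarith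
  exact_mod_cast h3

lemma card_highDegree_lt {V : Type*} [Fintype V] [DecidableEq V] {E : Finset (Finset V)}
    {k s D : ℕ} (hE : ∀ e ∈ E, e.card = k) (hs : 0 < s)
    (h1 : ∀ S : Finset V, S.card = s →
      2 * (E.filter fun e => 1 ≤ (e ∩ S).card).card + k * s ≤ D * s)
    (h3 : ∀ S : Finset V, S.card = s → (E.filter fun e => 3 ≤ (e ∩ S).card).card ≤ S.card) :
    ((Finset.univ : Finset V).filter fun v => D < (E.filter fun e => v ∈ e).card).card < s := by
  by_contra! hcon
  obtain ⟨S, hS, hSs⟩ := Finset.exists_subset_card_eq hcon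
  have hlow : s * (D + 1) ≤ ∑ v ∈ S, (E.filter fun e => v ∈ e).card := by
    rw [← hSs, ← smul_eq_mul]
    exact Finset.card_nsmul_le_sum _ _ _ fun v hv => (Finset.mem_filter.1 (hS hv)).2
  have hup : ∑ e ∈ E, (e ∩ S).card ≤
      2 * (E.filter fun e => 1 ≤ (e ∩ S).card).card
        + k * (E.filter fun e => 3 ≤ (e ∩ S).card).card := by
    rw [Finset.card_filter, Finset.card_filter, Finset.mul_sum, Finset.mul_sum,
      ← Finset.sum_add_distrib]
    refine Finset.sum_le_sum fun e he => ?_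
    have : (e ∩ S).card ≤ k := hE e he ▸ Finset.card_le_card Finset.inter_subset_left
    split_ifs <;> omega
  rw [sum_degree_eq] at hlow
  have := h1 S hSs
  have h3' := Nat.mul_le_mul_left k (h3 S hSs)
  rw [hSs] at h3'
  nlinarith

theorem rChoosable_of_sparse {V : Type*} [Fintype V] [DecidableEq V] {E : Finset (Finset V)}
    {k r m s D : ℕ} (hk : 4 ≤ k) (hr : 2 ≤ r) (hE : ∀ e ∈ E, e.card = k)
    (hD : 8 * k * D ≤ r ^ (k - 1)) (hkr : 16 * k ^ 2 ≤ r ^ (k - 3)) (hs : 0 < s)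
    (hm : 2 * s ≤ m)
    (h1 : ∀ S : Finset V, S.card = s →
      2 * (E.filter fun e => 1 ≤ (e ∩ S).card).card + k * s ≤ D * s)
    (h3 : ∀ S : Finset V, S.card ≤ m → (E.filter fun e => 3 ≤ (e ∩ S).card).card ≤ S.card)
    (h4 : ∀ S : Finset V, S.card ≤ m →
      2 * (E.filter fun e => 4 ≤ (e ∩ S).card).card ≤ S.card) :
    RChoosable r E := by
  intro L hL
  have hW₀ := card_highDegree_lt hE hs h1 fun S hS => h3 S (by omega)
  obtain ⟨W, hsub, hWc, hW⟩ := exists_closed_superset hE h3 _ (by omega :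
    2 * ((Finset.univ : Finset V).filter fun v => D < (E.filter fun e => v ∈ e).card).card < m)
  have hWm : W.card ≤ m := by omega
  obtain ⟨c₀, hc₀, hbig⟩ := exists_coloring_of_hall (E.filter fun e => 4 ≤ (e ∩ W).card) W L
    (fun v => by rw [hL]; exact hr) (by
      intro F hF
      set S := F.biUnion fun e => e ∩ W
      have hSW : S ⊆ W := Finset.biUnion_subset.2 fun e _ => Finset.inter_subset_right
      refine le_trans ?_ (h4 S ((Finset.card_le_card hSW).trans hWm))
      refine Nat.mul_le_mul_left 2 (Finset.card_le_card fun e he => ?_)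
      obtain ⟨heE, he4⟩ := Finset.mem_filter.1 (hF he)
      refine Finset.mem_filter.2 ⟨heE, he4.trans (Finset.card_le_card ?_)⟩
      exact Finset.subset_inter Finset.inter_subset_left
        (Finset.subset_biUnion_of_mem (fun e => e ∩ W) he))
  set F := E.filter fun e => ¬ 4 ≤ (e ∩ W).card with hF
  have hT : ∀ (v : V) (e : Finset V), ∃ T : Finset V, e ∈ F → v ∈ e → v ∉ W →
      (T ⊆ e ∧ Disjoint T W ∧ v ∉ T ∧ ∃ u ∈ e, u ≠ v ∧ u ∉ T) ∧
        k - 4 ≤ T.card ∧ ((e ∩ W).card ≤ 1 → k - 2 ≤ T.card) := by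
    intro v e
    by_cases he : e ∈ F
    swap
    · exact ⟨∅, fun h => absurd h he⟩
    by_cases hve : v ∈ e
    swap
    · exact ⟨∅, fun _ h => absurd h hve⟩
    by_cases hvW : v ∈ W
    · exact ⟨∅, fun _ _ h => absurd hvW h⟩
    obtain ⟨heE, he4⟩ := Finset.mem_filter.1 he
    have hek := hE e heE
    rcases (e ∩ W).eq_empty_or_nonempty with hempty | ⟨u, hu⟩
    · have hcard : (e.erase v).card = k - 1 := by rw [Finset.card_erase_of_mem hve, hek]
      obtain ⟨u, hu⟩ := Finset.card_pos.1 (by omega : 0 < (e.erase v).card)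
      have hcard' : ((e.erase v).erase u).card = k - 2 := by
        rw [Finset.card_erase_of_mem hu, hcard]; omega
      have hss : (e.erase v).erase u ⊆ e := (Finset.erase_subset _ _).trans (Finset.erase_subset _ _)
      refine ⟨(e.erase v).erase u, fun _ _ _ => ⟨⟨hss, ?_, by simp, u,
        Finset.mem_of_mem_erase hu, Finset.ne_of_mem_erase hu, by simp⟩, by omega, by omega⟩⟩
      exact (Finset.disjoint_iff_inter_eq_empty.2 hempty).mono_left hss
    · rw [Finset.mem_inter] at hu
      have hv' : v ∈ e \ W := Finset.mem_sdiff.2 ⟨hve, hvW⟩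
      have hcard : ((e \ W).erase v).card = k - (e ∩ W).card - 1 := by
        have := Finset.card_sdiff_add_card_inter e W
        rw [Finset.card_erase_of_mem hv']
        omega
      refine ⟨(e \ W).erase v, fun _ _ _ => ⟨⟨(Finset.erase_subset _ _).trans Finset.sdiff_subset,
        Finset.sdiff_disjoint.mono_left (Finset.erase_subset _ _), by simp, u, hu.1,
        fun h => hvW (h ▸ hu.2), by simp [hu.2]⟩, by omega, by omega⟩⟩
  choose T hT using hT
  have hk0 : (0 : ℝ) < k := by exact_mod_cast (by omega : 0 < k)
  have hk4 : (4 : ℝ) ≤ k := by exact_mod_cast hk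
  have hr2 : (2 : ℝ) ≤ r := by exact_mod_cast hr
  set x : ℝ := 1 - 1 / (2 * k) with hx
  have hxk : 1 / (2 * (k : ℝ)) ≤ 1 / 2 := by
    rw [div_le_div_iff₀ (by positivity) (by norm_num)]; linarith
  have hx2 : 1 / 2 ≤ x := by rw [hx]; linarith
  set β : ℝ := r * x with hβdef
  have hβ1 : 1 ≤ β := by nlinarith
  have hβ : 0 < β := by linarith
  have hpow : ∀ j ≤ k, (r : ℝ) ^ j / 2 ≤ β ^ j := by
    intro j hj
    rw [hβdef, mul_pow, div_eq_mul_one_div]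
    refine mul_le_mul_of_nonneg_left ?_ (by positivity)
    have h := one_add_mul_le_pow (a := -(1 / (2 * (k : ℝ)))) (by linarith) j
    have hj' : (j : ℝ) ≤ k := by exact_mod_cast hj
    have hjk : (j : ℝ) * (1 / (2 * k)) ≤ 1 / 2 := by
      calc (j : ℝ) * (1 / (2 * k)) ≤ k * (1 / (2 * k)) :=
            mul_le_mul_of_nonneg_right hj' (by positivity)
        _ = 1 / 2 := by field_simp
    calc (1 : ℝ) / 2 ≤ 1 + j * -(1 / (2 * k)) := by linarith
      _ ≤ _ := by rw [hx, sub_eq_add_neg]; exact h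
  have hinv : ∀ j t : ℕ, j ≤ k → j ≤ t → (β ^ t)⁻¹ ≤ 2 / (r : ℝ) ^ j := by
    intro j t hj ht
    calc (β ^ t)⁻¹ ≤ (β ^ j)⁻¹ := inv_anti₀ (by positivity) (pow_le_pow_right₀ hβ1 ht)
      _ ≤ ((r : ℝ) ^ j / 2)⁻¹ := inv_anti₀ (by positivity) (hpow j hj)
      _ = 2 / (r : ℝ) ^ j := by rw [inv_div]
  refine exists_coloring_of_sum_le (F := F) (W := W) hβ hL hc₀ T ?_ ?_ ?_ ?_
  · intro e he heF
    refine hbig e (Finset.mem_filter.2 ⟨he, ?_⟩)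
    by_contra h
    exact heF (Finset.mem_filter.2 ⟨he, h⟩)
  · intro e he heW
    obtain ⟨heE, he4⟩ := Finset.mem_filter.1 he
    rw [Finset.inter_eq_left.2 heW, hE e heE] at he4
    exact he4 hk
  · exact fun e he v hv hvW => (hT v e he hv hvW).1
  · intro v hv
    have hdeg : (E.filter fun e => v ∈ e).card ≤ D := by
      by_contra h
      exact hv (hsub (Finset.mem_filter.2 ⟨Finset.mem_univ _, by omega⟩))
    have hterm : ∀ e ∈ F.filter fun e => v ∈ e, (β ^ (T v e).card)⁻¹ ≤
        2 / (r : ℝ) ^ (k - 2) + if 2 ≤ (e ∩ W).card then 2 / (r : ℝ) ^ (k - 4) else 0 := by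
      intro e he
      obtain ⟨heF, hve⟩ := Finset.mem_filter.1 he
      obtain ⟨-, hT4, hT2⟩ := hT v e heF hve hv
      split_ifs with h
      · have := hinv (k - 4) _ (by omega) hT4
        have : (0 : ℝ) ≤ 2 / (r : ℝ) ^ (k - 2) := by positivity
        linarith
      · rw [add_zero]
        exact hinv (k - 2) _ (by omega) (hT2 (by omega))
    refine (Finset.sum_le_sum hterm).trans ?_
    rw [Finset.sum_add_distrib, ← Finset.sum_filter, Finset.sum_const, Finset.sum_const,
      nsmul_eq_mul, nsmul_eq_mul]
    have hc1 : ((F.filter fun e => v ∈ e).card : ℝ) ≤ D := by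
      exact_mod_cast (Finset.card_le_card (Finset.filter_subset_filter _
        (Finset.filter_subset _ _))).trans hdeg
    have hc2 : (((F.filter fun e => v ∈ e).filter fun e => 2 ≤ (e ∩ W).card).card : ℝ)
        ≤ 2 * k := by
      rw [Finset.filter_filter]
      exact_mod_cast (Finset.card_le_card (Finset.filter_subset_filter _
        (Finset.filter_subset _ _))).trans (hW v hv)
    have hD' : 8 * (k : ℝ) * D ≤ r ^ (k - 2) * r := by
      rw [← pow_succ, show k - 2 + 1 = k - 1 by omega]
      exact_mod_cast hD
    have hkr' : 16 * (k : ℝ) ^ 2 ≤ r ^ (k - 4) * r := by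
      rw [← pow_succ, show k - 4 + 1 = k - 3 by omega]
      exact_mod_cast hkr
    have hb1 : (D : ℝ) * (2 / (r : ℝ) ^ (k - 2)) ≤ r / (4 * k) := by
      rw [mul_div_assoc', div_le_div_iff₀ (by positivity) (by positivity)]
      linarith
    have hb2 : 2 * (k : ℝ) * (2 / (r : ℝ) ^ (k - 4)) ≤ r / (4 * k) := by
      rw [mul_div_assoc', div_le_div_iff₀ (by positivity) (by positivity)]
      linarith
    have hrb : (r : ℝ) - β = r / (4 * k) + r / (4 * k) := by
      rw [hβdef, hx]; field_simp; ring
    rw [hrb]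
    refine add_le_add (le_trans ?_ hb1) (le_trans ?_ hb2)
    · exact mul_le_mul_of_nonneg_right hc1 (by positivity)
    · exact mul_le_mul_of_nonneg_right hc2 (by positivity)

lemma sum_superset_eq_pow {α : Type*} [DecidableEq α] {Ω F : Finset α} (hF : F ⊆ Ω) (p : ℝ) :
    ∑ E ∈ Ω.powerset, (if F ⊆ E then p ^ E.card * (1 - p) ^ (Ω.card - E.card) else 0)
      = p ^ F.card := by
  have h := Finset.prod_add (fun _ : α => p) (fun e => if e ∈ F then 0 else 1 - p) Ω
  have hl : ∏ e ∈ Ω, (p + if e ∈ F then 0 else 1 - p) = p ^ F.card := by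
    have : ∀ e ∈ Ω, (p + if e ∈ F then 0 else 1 - p) = if e ∈ F then p else 1 := by
      intro e _
      split_ifs <;> ring
    rw [Finset.prod_congr rfl this, Finset.prod_ite_mem, Finset.inter_eq_right.2 hF,
      Finset.prod_const]
  rw [← hl, h]
  refine Finset.sum_congr rfl fun E hE => ?_
  rw [Finset.mem_powerset] at hE
  rw [Finset.prod_const]
  split_ifs with hFE
  · congr 1
    rw [← Finset.card_sdiff_of_subset hE, ← Finset.prod_const]
    refine Finset.prod_congr rfl fun e he => ?_
    rw [if_neg fun h => (Finset.mem_sdiff.1 he).2 (hFE h)]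
  · obtain ⟨e, heF, heE⟩ := Finset.not_subset.1 hFE
    rw [Finset.prod_eq_zero (i := e) (Finset.mem_sdiff.2 ⟨hF heF, heE⟩) (by simp [heF]), mul_zero]

lemma hyperProb_superset {n k : ℕ} (p : ℝ) {F : Finset (Finset (Fin n))}
    (hF : F ⊆ (Finset.univ : Finset (Fin n)).powersetCard k) :
    hyperProb n k p (fun E => F ⊆ E) = p ^ F.card := by
  rw [← sum_superset_eq_pow hF p, hyperProb]
  refine Finset.sum_congr rfl fun E _ => ?_
  congr

lemma hyperProb_add_hyperProb_not (n k : ℕ) (p : ℝ) (P : Finset (Finset (Fin n)) → Prop) :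
    hyperProb n k p P + hyperProb n k p (fun E => ¬ P E) = 1 := by
  have h := hyperProb_superset (n := n) (k := k) p (Finset.empty_subset _)
  rw [Finset.card_empty, pow_zero] at h
  rw [← h]
  simp only [hyperProb, ← Finset.sum_add_distrib]
  refine Finset.sum_congr rfl fun E _ => ?_
  by_cases hP : P E <;> simp [hP]

lemma hyperProb_nonneg {n k : ℕ} {p : ℝ} (hp0 : 0 ≤ p) (hp1 : p ≤ 1)
    (P : Finset (Finset (Fin n)) → Prop) : 0 ≤ hyperProb n k p P := by
  have : 0 ≤ 1 - p := by linarith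
  refine Finset.sum_nonneg fun E _ => ?_
  split_ifs <;> positivity

lemma hyperProb_le_sum {n k : ℕ} {p : ℝ} (hp0 : 0 ≤ p) (hp1 : p ≤ 1) {ι : Type*} (I : Finset ι)
    {P : Finset (Finset (Fin n)) → Prop} {Q : ι → Finset (Finset (Fin n)) → Prop}
    (h : ∀ E ⊆ (Finset.univ : Finset (Fin n)).powersetCard k, P E → ∃ i ∈ I, Q i E) :
    hyperProb n k p P ≤ ∑ i ∈ I, hyperProb n k p (Q i) := by
  have hp : 0 ≤ 1 - p := by linarith
  simp only [hyperProb]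
  rw [Finset.sum_comm]
  refine Finset.sum_le_sum fun E hE => ?_
  have hnn : ∀ i ∈ I, (0 : ℝ) ≤ if Q i E then p ^ E.card *
      (1 - p) ^ (((Finset.univ : Finset (Fin n)).powersetCard k).card - E.card) else 0 := by
    intro i _
    split_ifs <;> positivity
  by_cases hP : P E
  · obtain ⟨i, hi, hQ⟩ := h E (Finset.mem_powerset.1 hE) hP
    refine le_trans (le_of_eq ?_) (Finset.single_le_sum hnn hi)
    rw [if_pos hP, if_pos hQ]
  · rw [if_neg hP]
    exact Finset.sum_nonneg hnn

lemma hyperProb_le_add {n k : ℕ} {p : ℝ} (hp0 : 0 ≤ p) (hp1 : p ≤ 1)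
    {P Q R : Finset (Finset (Fin n)) → Prop}
    (h : ∀ E ⊆ (Finset.univ : Finset (Fin n)).powersetCard k, P E → Q E ∨ R E) :
    hyperProb n k p P ≤ hyperProb n k p Q + hyperProb n k p R := by
  have := hyperProb_le_sum (k := k) hp0 hp1 (Finset.univ : Finset Bool) (P := P)
    (Q := fun b => cond b Q R) (fun E hE hP => by simpa [or_comm] using h E hE hP)
  simpa using this

/-- Some set of `s` vertices meets at least `f` edges of `E` in at least `j` vertices each. -/
def HasDenseSet {V : Type*} [DecidableEq V] (j s f : ℕ) (E : Finset (Finset V)) : Prop :=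
  ∃ S : Finset V, S.card = s ∧ f ≤ (E.filter fun e => j ≤ (e ∩ S).card).card

lemma card_filter_le_card_inter {V : Type*} [Fintype V] [DecidableEq V] (k j : ℕ)
    (S : Finset V) :
    (((Finset.univ : Finset V).powersetCard k).filter fun e => j ≤ (e ∩ S).card).card
      ≤ S.card.choose j * (Fintype.card V - j).choose (k - j) := by
  have hsub : ((Finset.univ : Finset V).powersetCard k).filter (fun e => j ≤ (e ∩ S).card) ⊆
      (S.powersetCard j).biUnion fun T => ((Finset.univ \ T).powersetCard (k - j)).image
        fun e => e ∪ T := by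
    intro e he
    rw [Finset.mem_filter, Finset.mem_powersetCard] at he
    obtain ⟨⟨-, hek⟩, hj⟩ := he
    obtain ⟨T, hT, hTj⟩ := Finset.exists_subset_card_eq hj
    have hTe := hT.trans Finset.inter_subset_left
    refine Finset.mem_biUnion.2 ⟨T, Finset.mem_powersetCard.2
      ⟨hT.trans Finset.inter_subset_right, hTj⟩, Finset.mem_image.2 ⟨e \ T, ?_, ?_⟩⟩
    · refine Finset.mem_powersetCard.2 ⟨Finset.sdiff_subset_sdiff (Finset.subset_univ _) subset_rfl,
        ?_⟩
      rw [Finset.card_sdiff_of_subset hTe, hek, hTj]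
    · exact Finset.sdiff_union_of_subset hTe
  refine (Finset.card_le_card hsub).trans (Finset.card_biUnion_le.trans ?_)
  rw [← Finset.card_powersetCard j S, ← smul_eq_mul]
  refine Finset.sum_le_card_nsmul _ _ _ fun T hT => Finset.card_image_le.trans ?_
  rw [Finset.card_powersetCard, Finset.card_sdiff_of_subset (Finset.subset_univ _),
    Finset.card_univ, (Finset.mem_powersetCard.1 hT).2]

lemma hyperProb_hasDenseSet_le {n k : ℕ} {p : ℝ} (hp0 : 0 ≤ p) (hp1 : p ≤ 1) (j s f : ℕ) :
    hyperProb n k p (HasDenseSet j s f) ≤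
      n.choose s * (((s.choose j * (n - j).choose (k - j)).choose f) * p ^ f) := by
  have hS : ∀ S ∈ (Finset.univ : Finset (Fin n)).powersetCard s,
      hyperProb n k p (fun E => f ≤ (E.filter fun e => j ≤ (e ∩ S).card).card) ≤
        ((s.choose j * (n - j).choose (k - j)).choose f) * p ^ f := by
    intro S hS
    set Ω := (Finset.univ : Finset (Fin n)).powersetCard k with hΩ
    set M := (Ω.filter fun e => j ≤ (e ∩ S).card).powersetCard f with hM
    have h1 := hyperProb_le_sum (k := k) hp0 hp1 M
      (P := fun E => f ≤ (E.filter fun e => j ≤ (e ∩ S).card).card) (Q := fun F E => F ⊆ E) (by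
        intro E hE hf
        obtain ⟨F, hF, hFf⟩ := Finset.exists_subset_card_eq hf
        exact ⟨F, Finset.mem_powersetCard.2 ⟨hF.trans (Finset.filter_subset_filter _ hE), hFf⟩,
          hF.trans (Finset.filter_subset _ _)⟩)
    refine h1.trans ?_
    have h2 : ∀ F ∈ M, hyperProb n k p (fun E => F ⊆ E) = p ^ f := by
      intro F hF
      rw [hM, Finset.mem_powersetCard] at hF
      rw [hyperProb_superset p (hF.1.trans (Finset.filter_subset _ _)), hF.2]
    rw [Finset.sum_congr rfl h2, Finset.sum_const, nsmul_eq_mul, hM, Finset.card_powersetCard]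
    refine mul_le_mul_of_nonneg_right ?_ (by positivity)
    have h3 := card_filter_le_card_inter k j S
    rw [Fintype.card_fin, (Finset.mem_powersetCard.1 hS).2] at h3
    exact_mod_cast Nat.choose_le_choose f h3
  have h := hyperProb_le_sum (k := k) hp0 hp1 ((Finset.univ : Finset (Fin n)).powersetCard s)
    (P := HasDenseSet j s f)
    (Q := fun S E => f ≤ (E.filter fun e => j ≤ (e ∩ S).card).card) (by
      rintro E - ⟨S, hS, hf⟩
      exact ⟨S, Finset.mem_powersetCard.2 ⟨Finset.subset_univ _, hS⟩, hf⟩)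
  refine h.trans ((Finset.sum_le_card_nsmul _ _ _ hS).trans (le_of_eq ?_))
  rw [nsmul_eq_mul, Finset.card_powersetCard, Finset.card_univ, Fintype.card_fin]

lemma choose_mul_pow_le {s n : ℕ} (h : s ≤ n) (j : ℕ) :
    s.choose j * n ^ j ≤ n.choose j * s ^ j := by
  induction j with
  | zero => simp
  | succ j ih =>
    refine Nat.le_of_mul_le_mul_right ?_ (by omega : 0 < j + 1)
    have hs : (s - j) * n ≤ (n - j) * s := by
      rw [Nat.sub_mul, Nat.sub_mul, mul_comm s n]
      exact Nat.sub_le_sub_left (Nat.mul_le_mul_left j h) _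
    calc s.choose (j + 1) * n ^ (j + 1) * (j + 1)
        = (s.choose (j + 1) * (j + 1)) * n ^ (j + 1) := by ring
      _ = (s.choose j * n ^ j) * ((s - j) * n) := by rw [Nat.choose_succ_right_eq]; ring
      _ ≤ (n.choose j * s ^ j) * ((n - j) * s) := Nat.mul_le_mul ih hs
      _ = (n.choose (j + 1) * (j + 1)) * s ^ (j + 1) := by rw [Nat.choose_succ_right_eq]; ring
      _ = _ := by ring

lemma choose_mul_choose_mul_pow_le {s n j k : ℕ} (hs : s ≤ n) (hj : j ≤ k) :
    s.choose j * (n - j).choose (k - j) * n ^ j ≤ k ^ j * s ^ j * n.choose k := by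
  calc s.choose j * (n - j).choose (k - j) * n ^ j
      = (s.choose j * n ^ j) * (n - j).choose (k - j) := by ring
    _ ≤ (n.choose j * s ^ j) * (n - j).choose (k - j) :=
        Nat.mul_le_mul_right _ (choose_mul_pow_le hs j)
    _ = s ^ j * (n.choose k * k.choose j) := by rw [mul_right_comm, mul_comm, ← Nat.choose_mul hj]
    _ ≤ s ^ j * (n.choose k * k ^ j) := by gcongr; exact Nat.choose_le_pow k j
    _ = _ := by ring

lemma choose_le_three_mul_div_pow (N : ℕ) {f : ℕ} (hf : 0 < f) :
    (N.choose f : ℝ) ≤ (3 * N / f) ^ f := by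
  have hf' : (0 : ℝ) < f := by exact_mod_cast hf
  have h1 : (N.choose f : ℝ) ≤ (N : ℝ) ^ f / (f.factorial : ℝ) := Nat.choose_le_pow_div f N
  have h2 : (f : ℝ) ^ f / (f.factorial : ℝ) ≤ 3 ^ f := by
    calc (f : ℝ) ^ f / (f.factorial : ℝ) ≤ Real.exp f :=
          Real.pow_div_factorial_le_exp _ hf'.le f
      _ = Real.exp 1 ^ f := by rw [← Real.exp_nat_mul, mul_one]
      _ ≤ 3 ^ f := by
        gcongr
        linarith [Real.exp_one_lt_d9]
  calc (N.choose f : ℝ) ≤ (N : ℝ) ^ f / (f.factorial : ℝ) := h1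
    _ = ((N : ℝ) / f) ^ f * ((f : ℝ) ^ f / (f.factorial : ℝ)) := by
        rw [div_pow]; field_simp
    _ ≤ ((N : ℝ) / f) ^ f * 3 ^ f := by gcongr
    _ = (3 * N / f) ^ f := by rw [← mul_pow]; ring

lemma hyperProb_hasDenseSet_le_pow {n k : ℕ} {p K : ℝ} (hp0 : 0 ≤ p) (hp1 : p ≤ 1)
    (hK : p ≤ K * (n / n.choose k)) {j s f : ℕ} (hj : j ≤ k) (hkn : k ≤ n) (hs : 0 < s)
    (hsn : s ≤ n) (hf : 0 < f) :
    hyperProb n k p (HasDenseSet j s f) ≤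
      (3 * n / s) ^ s * (3 * (k ^ j * (s / n) ^ j * (K * n)) / f) ^ f := by
  have hn : (0 : ℝ) < n := by exact_mod_cast (by omega : 0 < n)
  have hC : (0 : ℝ) < n.choose k := by exact_mod_cast Nat.choose_pos hkn
  set M := s.choose j * (n - j).choose (k - j) with hM
  have hMp : (M : ℝ) * p ≤ k ^ j * (s / n) ^ j * (K * n) := by
    have h1 : (M : ℝ) * n ^ j ≤ k ^ j * s ^ j * n.choose k := by
      exact_mod_cast choose_mul_choose_mul_pow_le hsn hj
    have h2 : (M : ℝ) ≤ k ^ j * (s / n) ^ j * n.choose k := by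
      rw [div_pow, ← mul_div_assoc, div_mul_eq_mul_div, le_div_iff₀ (by positivity)]
      exact h1
    have h3 : n.choose k * p ≤ K * n := by
      calc n.choose k * p ≤ n.choose k * (K * (n / n.choose k)) := by gcongr
        _ = K * n := by field_simp
    calc (M : ℝ) * p ≤ k ^ j * (s / n) ^ j * n.choose k * p := by gcongr
      _ = k ^ j * (s / n) ^ j * (n.choose k * p) := by ring
      _ ≤ _ := by gcongr
  refine (hyperProb_hasDenseSet_le hp0 hp1 j s f).trans ?_
  refine mul_le_mul (choose_le_three_mul_div_pow n hs) ?_ (by positivity) (by positivity)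
  calc (M.choose f : ℝ) * p ^ f ≤ (3 * M / f) ^ f * p ^ f := by
        gcongr
        exact choose_le_three_mul_div_pow M hf
    _ = (3 * (M * p) / f) ^ f := by rw [← mul_pow]; ring
    _ ≤ _ := by gcongr

/-- Small vertex sets are unlikely to be dense. -/
lemma hyperProb_hasDenseSet_small_le {n k : ℕ} {p K : ℝ} (hp0 : 0 ≤ p) (hp1 : p ≤ 1) (hK0 : 0 < K)
    (hK : p ≤ K * (n / n.choose k)) {a s f : ℕ} (ha0 : 0 < a) (ha : a ≤ 2) (hk : 4 ≤ k)
    (hkn : k ≤ n) (hs : 0 < s) (hsn : s ≤ n) (hsf : s ≤ a * f)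
    (hsB : 54 * k ^ 4 * K * s ≤ n / 4) :
    hyperProb n k p (HasDenseSet (a + 2) s f) ≤
      4 * (54 * k ^ 4 * K) / n * (s * (1 / 2) ^ s) := by
  have hf : 0 < f := by
    rcases Nat.eq_zero_or_pos f with rfl | h
    · omega
    · exact h
  have hn : (0 : ℝ) < n := by exact_mod_cast (by omega : 0 < n)
  have hs' : (0 : ℝ) < s := by exact_mod_cast hs
  have hf' : (0 : ℝ) < f := by exact_mod_cast hf
  have hk1 : (1 : ℝ) ≤ k := by exact_mod_cast (by omega : 1 ≤ k)
  have hsn' : (s : ℝ) ≤ n := by exact_mod_cast hsn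
  have hsf' : (s : ℝ) ≤ a * f := by exact_mod_cast hsf
  set B : ℝ := 54 * k ^ 4 * K with hB
  have hB0 : 0 < B := by positivity
  refine (hyperProb_hasDenseSet_le_pow hp0 hp1 hK (by omega) hkn hs hsn hf).trans ?_
  have h3 : 1 ≤ 3 * (n : ℝ) / s := by
    rw [le_div_iff₀ hs']; linarith
  have hbase : (3 * (n : ℝ) / s) ^ a * (3 * (k ^ (a + 2) * (s / n) ^ (a + 2) * (K * n)) / f)
      ≤ B * s / n := by
    have hsplit : (3 * (n : ℝ) / s) ^ a * (3 * (k ^ (a + 2) * (s / n) ^ (a + 2) * (K * n)) / f)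
        = 3 ^ (a + 1) * k ^ (a + 2) * K * (s / n) * (s / f) := by
      have : (3 * (n : ℝ) / s) ^ a * (s / n) ^ a = 3 ^ a := by
        rw [← mul_pow]; congr 1; field_simp
      calc _ = ((3 * (n : ℝ) / s) ^ a * (s / n) ^ a) *
            (3 * k ^ (a + 2) * (s / n) ^ 2 * (K * n) / f) := by ring
        _ = _ := by rw [this]; field_simp; ring
    rw [hsplit]
    have hsf2 : (s : ℝ) / f ≤ 2 := by
      rw [div_le_iff₀ hf']
      have : (a : ℝ) ≤ 2 := by exact_mod_cast ha
      nlinarith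
    have ha3 : (3 : ℝ) ^ (a + 1) ≤ 3 ^ 3 := pow_le_pow_right₀ (by norm_num) (by omega)
    have hka : (k : ℝ) ^ (a + 2) ≤ k ^ 4 := pow_le_pow_right₀ hk1 (by omega)
    calc 3 ^ (a + 1) * (k : ℝ) ^ (a + 2) * K * (s / n) * (s / f)
        ≤ 3 ^ 3 * (k : ℝ) ^ 4 * K * (s / n) * 2 := by gcongr
      _ = B * s / n := by rw [hB]; ring
  have hx : B * s / n ≤ 1 / 4 := by
    rw [div_le_iff₀ hn]; linarith
  have hx0 : 0 ≤ B * s / n := by positivity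
  calc (3 * (n : ℝ) / s) ^ s * (3 * (k ^ (a + 2) * (s / n) ^ (a + 2) * (K * n)) / f) ^ f
      ≤ (3 * (n : ℝ) / s) ^ (a * f) *
          (3 * (k ^ (a + 2) * (s / n) ^ (a + 2) * (K * n)) / f) ^ f := by
        gcongr
    _ = ((3 * (n : ℝ) / s) ^ a *
          (3 * (k ^ (a + 2) * (s / n) ^ (a + 2) * (K * n)) / f)) ^ f := by
        rw [pow_mul, ← mul_pow]
    _ ≤ (B * s / n) ^ f := by gcongr
    _ = (B * s / n) ^ (f - 1) * (B * s / n) := by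
        rw [← pow_succ, Nat.sub_add_cancel hf]
    _ ≤ (1 / 4) ^ (f - 1) * (B * s / n) := by gcongr
    _ = 4 * (1 / 4) ^ f * (B * s / n) := by
        obtain ⟨g, rfl⟩ := Nat.exists_eq_add_of_lt hf
        simp only [zero_add, Nat.add_sub_cancel, pow_succ]
        ring
    _ ≤ 4 * (1 / 2) ^ s * (B * s / n) := by
        gcongr
        calc (1 / 4 : ℝ) ^ f = (1 / 2) ^ (2 * f) := by rw [pow_mul]; norm_num
          _ ≤ (1 / 2) ^ s := pow_le_pow_of_le_one (by norm_num) (by norm_num)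
              (hsf.trans (Nat.mul_le_mul_right f ha))
    _ = _ := by ring

lemma sum_Icc_mul_half_pow_le (m : ℕ) : ∑ s ∈ Finset.Icc 1 m, (s : ℝ) * (1 / 2) ^ s ≤ 2 := by
  have h := tsum_coe_mul_geometric_of_norm_lt_one (r := (1 / 2 : ℝ)) (by norm_num)
  have hs := (hasSum_coe_mul_geometric_of_norm_lt_one (r := (1 / 2 : ℝ)) (by norm_num)).summable
  have := hs.sum_le_tsum (Finset.Icc 1 m) (fun i _ => by positivity)
  rw [h] at this
  norm_num at this ⊢
  exact this

lemma pow_four_le_four_pow {q : ℕ} (hq : 4 ≤ q) : q ^ 4 ≤ 4 ^ q := by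
  induction q, hq using Nat.le_induction with
  | base => norm_num
  | succ q hq ih =>
    have h : (q + 1) ^ 4 ≤ 4 * q ^ 4 := by
      have h2 : (q + 1) ^ 2 ≤ 2 * q ^ 2 := by nlinarith
      calc (q + 1) ^ 4 = ((q + 1) ^ 2) ^ 2 := by ring
        _ ≤ (2 * q ^ 2) ^ 2 := Nat.pow_le_pow_left h2 2
        _ = 4 * q ^ 4 := by ring
    calc (q + 1) ^ 4 ≤ 4 * q ^ 4 := h
      _ ≤ 4 * 4 ^ q := Nat.mul_le_mul_left 4 ih
      _ = 4 ^ (q + 1) := by ring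

lemma sq_le_two_pow {k : ℕ} (hk : 20 ≤ k) : 128 * k ^ 2 ≤ 2 ^ (k - 3) := by
  induction k, hk using Nat.le_induction with
  | base => norm_num
  | succ k hk ih =>
    have h : 2 ^ (k + 1 - 3) = 2 * 2 ^ (k - 3) := by
      rw [show k + 1 - 3 = (k - 3) + 1 by omega, pow_succ, mul_comm]
    rw [h]
    nlinarith

lemma exists_parameters {k R : ℕ} (hk : 20 ≤ k) (hR : 512 * k ^ 2 ≤ R) :
    ∃ q D : ℕ, 8 * k * D ≤ R ∧ 2 * q + k ≤ D ∧ R ≤ 64 * k * q ∧ 0 < q ∧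
      4 * k ^ 2 * R ≤ 4 ^ q := by
  have hk0 : 0 < 32 * k := by omega
  set q := R / (32 * k) with hq
  have h1 : 32 * k * q ≤ R := Nat.mul_div_le R (32 * k)
  have h2 : R < 32 * k * (q + 1) := Nat.lt_mul_div_succ R hk0
  have h16 : 16 * k ≤ q := by
    rw [hq, Nat.le_div_iff_mul_le hk0]
    nlinarith
  have h64 : R ≤ 64 * k * q := by nlinarith
  refine ⟨q, 4 * q, by nlinarith, by omega, h64, by omega, ?_⟩
  refine le_trans ?_ (pow_four_le_four_pow (by omega))
  have h3 : (16 * k) ^ 3 ≤ q ^ 3 := Nat.pow_le_pow_left h16 3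
  calc 4 * k ^ 2 * R ≤ 4 * k ^ 2 * (64 * k * q) := Nat.mul_le_mul_left _ h64
    _ = 256 * k ^ 3 * q := by ring
    _ ≤ (16 * k) ^ 3 * q := by
      refine Nat.mul_le_mul_right q ?_
      ring_nf
      omega
    _ ≤ q ^ 3 * q := Nat.mul_le_mul_right q h3
    _ = q ^ 4 := by ring

lemma hyperProb_not_rChoosable_le {n k r m s q D : ℕ} {p : ℝ} (hp0 : 0 ≤ p) (hp1 : p ≤ 1)
    (hk : 4 ≤ k) (hr : 2 ≤ r) (hD : 8 * k * D ≤ r ^ (k - 1)) (hkr : 16 * k ^ 2 ≤ r ^ (k - 3))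
    (hs : 0 < s) (hm : 2 * s ≤ m) (hq : 2 * q + k ≤ D) :
    hyperProb n k p (fun E => ¬ RChoosable r E) ≤
      hyperProb n k p (HasDenseSet 1 s (q * s)) +
        (∑ t ∈ Finset.Icc 1 m, hyperProb n k p (HasDenseSet 3 t t) +
          ∑ t ∈ Finset.Icc 1 m, hyperProb n k p (HasDenseSet 4 t ((t + 1) / 2))) := by
  have h1 := hyperProb_le_add (n := n) (k := k) hp0 hp1
    (P := fun E => ¬ RChoosable r E) (Q := HasDenseSet 1 s (q * s))
    (R := fun E => (∃ t ∈ Finset.Icc 1 m, HasDenseSet 3 t t E) ∨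
      ∃ t ∈ Finset.Icc 1 m, HasDenseSet 4 t ((t + 1) / 2) E) (by
    intro E hE hP
    by_contra! hcon
    obtain ⟨hn1, hn3, hn4⟩ := hcon
    refine hP (rChoosable_of_sparse hk hr (fun e he => (Finset.mem_powersetCard.1 (hE he)).2)
      hD hkr hs hm (fun S hS => ?_) (fun S hS => ?_) fun S hS => ?_)
    · have : (E.filter fun e => 1 ≤ (e ∩ S).card).card < q * s := by
        by_contra! h
        exact hn1 ⟨S, hS, h⟩
      have h : (2 * q + k) * s ≤ D * s := Nat.mul_le_mul_right s hq
      rw [add_mul, mul_assoc] at h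
      omega
    · rcases S.eq_empty_or_nonempty with rfl | hne
      · simp
      · by_contra! h
        exact hn3 S.card (Finset.mem_Icc.2 ⟨hne.card_pos, hS⟩) ⟨S, rfl, h.le⟩
    · rcases S.eq_empty_or_nonempty with rfl | hne
      · simp
      · by_contra! h
        exact hn4 S.card (Finset.mem_Icc.2 ⟨hne.card_pos, hS⟩) ⟨S, rfl, by omega⟩)
  refine h1.trans (add_le_add le_rfl ((hyperProb_le_add (k := k) hp0 hp1 fun E _ h => h).trans
    (add_le_add ?_ ?_)))
  · exact hyperProb_le_sum hp0 hp1 _ fun E _ h => h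
  · exact hyperProb_le_sum hp0 hp1 _ fun E _ h => h

lemma hyperProb_not_rChoosable_le_of_large {n k r : ℕ} {p K : ℝ} (hp0 : 0 ≤ p) (hp1 : p ≤ 1)
    (hk : 20 ≤ k) (hr : 2 ≤ r) (hKdef : K = 1 / 1296 * ((r : ℝ) ^ (k - 1) / (k : ℝ) ^ 2))
    (hK : p ≤ K * (n / n.choose k)) (hkn : k ≤ n) (hn : 16 * (54 * k ^ 4 * K) ≤ n) :
    hyperProb n k p (fun E => ¬ RChoosable r E) ≤
      (1 / 2) ^ ⌊n / (8 * (54 * k ^ 4 * K))⌋₊ + 16 * (54 * k ^ 4 * K) / n := by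
  have hr2 : (2 : ℝ) ≤ r := by exact_mod_cast hr
  have hk0 : (0 : ℝ) < k := by exact_mod_cast (by omega : 0 < k)
  have hn0 : (0 : ℝ) < n := by exact_mod_cast (by omega : 0 < n)
  have hpow3 : 128 * k ^ 2 ≤ r ^ (k - 3) :=
    (sq_le_two_pow hk).trans (Nat.pow_le_pow_left hr _)
  have hR : 512 * k ^ 2 ≤ r ^ (k - 1) := by
    rw [show k - 1 = (k - 3) + 2 by omega, pow_add]
    calc 512 * k ^ 2 = 128 * k ^ 2 * 2 ^ 2 := by ring
      _ ≤ r ^ (k - 3) * r ^ 2 := Nat.mul_le_mul hpow3 (Nat.pow_le_pow_left hr 2)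
  obtain ⟨q, D, hD, hqD, hqR, hq0, hq4⟩ := exists_parameters hk hR
  have hK0 : 0 < K := by rw [hKdef]; positivity
  set B : ℝ := 54 * k ^ 4 * K with hB
  have hB0 : 0 < B := by positivity
  have hBR : 24 * B = k ^ 2 * (r : ℝ) ^ (k - 1) := by
    rw [hB, hKdef]; field_simp; norm_num
  have hB1 : 1 ≤ B := by
    have h1 : (512 : ℝ) * k ^ 2 ≤ (r : ℝ) ^ (k - 1) := by exact_mod_cast hR
    have h2 : (20 : ℝ) ≤ k := by exact_mod_cast hk
    have h3 : (400 : ℝ) ≤ k ^ 2 := by nlinarith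
    have h4 : 400 * 1 ≤ (k : ℝ) ^ 2 * (r : ℝ) ^ (k - 1) :=
      mul_le_mul h3 (by linarith) (by norm_num) (by positivity)
    linarith
  set s := ⌊n / (8 * B)⌋₊ with hs
  set m := ⌊n / (4 * B)⌋₊ with hm
  have hnB : 2 ≤ n / (8 * B) := by
    rw [le_div_iff₀ (by positivity)]; linarith
  have hs0 : 0 < s := Nat.floor_pos.2 (by linarith)
  have hsle : (s : ℝ) ≤ n / (8 * B) := Nat.floor_le (by positivity)
  have hmle : (m : ℝ) ≤ n / (4 * B) := Nat.floor_le (by positivity)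
  have hsm : 2 * s ≤ m := by
    refine Nat.le_floor ?_
    push_cast
    calc 2 * (s : ℝ) ≤ 2 * (n / (8 * B)) := by linarith
      _ = n / (4 * B) := by field_simp; norm_num
  have hmn : m ≤ n := by
    have : (m : ℝ) ≤ n := hmle.trans (div_le_self hn0.le (by linarith))
    exact_mod_cast this
  have hslow : (n : ℝ) / (16 * B) ≤ s := by
    have h1 : (n : ℝ) / (8 * B) < s + 1 := Nat.lt_floor_add_one _
    have h2 : (n : ℝ) / (16 * B) = n / (8 * B) / 2 := by field_simp; norm_num
    rw [h2]; linarith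
  have hs0' : (0 : ℝ) < s := by exact_mod_cast hs0
  have hq0' : (0 : ℝ) < q := by exact_mod_cast hq0
  refine (hyperProb_not_rChoosable_le hp0 hp1 (by omega) hr hD (by omega) hs0 hsm hqD).trans
    (add_le_add ?_ ?_)
  · refine (hyperProb_hasDenseSet_le_pow hp0 hp1 hK (by omega) hkn hs0 (by omega)
      (Nat.mul_pos hq0 hs0)).trans ?_
    rw [pow_mul, ← mul_pow]
    refine pow_le_pow_left₀ (by positivity) ?_ _
    have h1 : 3 * (n : ℝ) / s ≤ 48 * B := by
      rw [div_le_iff₀ hs0']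
      rw [div_le_iff₀ (by positivity)] at hslow
      linarith
    have h2 : 3 * ((k : ℝ) ^ 1 * (s / n) ^ 1 * (K * n)) / ((q * s : ℕ) : ℝ) ≤ 1 / 4 := by
      have h3 : 3 * ((k : ℝ) ^ 1 * (s / n) ^ 1 * (K * n)) / ((q * s : ℕ) : ℝ) = 3 * (k * K) / q := by
        push_cast; field_simp
      have h4 : (k : ℝ) * K * k = 1 / 1296 * (r : ℝ) ^ (k - 1) := by
        rw [hKdef]; field_simp
      have h5 : (r : ℝ) ^ (k - 1) ≤ 64 * k * q := by exact_mod_cast hqR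
      rw [h3, div_le_iff₀ hq0']
      nlinarith
    have h3 : 4 * (k : ℝ) ^ 2 * (r : ℝ) ^ (k - 1) ≤ 4 ^ q := by exact_mod_cast hq4
    calc 3 * (n : ℝ) / s * (3 * ((k : ℝ) ^ 1 * (s / n) ^ 1 * (K * n)) / ((q * s : ℕ) : ℝ)) ^ q
        ≤ 48 * B * (1 / 4) ^ q := by gcongr
      _ ≤ 1 / 2 := by
        rw [one_div_pow, mul_one_div, div_le_iff₀ (by positivity)]
        linarith
  · have hsmall : ∀ t ∈ Finset.Icc 1 m, 0 < t ∧ t ≤ n ∧ B * t ≤ n / 4 := by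
      intro t ht
      rw [Finset.mem_Icc] at ht
      have htm : (t : ℝ) ≤ n / (4 * B) := le_trans (by exact_mod_cast ht.2) hmle
      rw [le_div_iff₀ (by positivity)] at htm
      exact ⟨ht.1, ht.2.trans hmn, by linarith⟩
    have hsum : ∀ (j : ℕ) (f : ℕ → ℕ), (∀ t ∈ Finset.Icc 1 m,
        hyperProb n k p (HasDenseSet j t (f t)) ≤ 4 * B / n * (t * (1 / 2) ^ t)) →
        ∑ t ∈ Finset.Icc 1 m, hyperProb n k p (HasDenseSet j t (f t)) ≤ 8 * B / n := by
      intro j f h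
      refine (Finset.sum_le_sum h).trans ?_
      rw [← Finset.mul_sum]
      calc _ ≤ 4 * B / n * 2 :=
            mul_le_mul_of_nonneg_left (sum_Icc_mul_half_pow_le m) (by positivity)
        _ = 8 * B / n := by ring
    have h3 := hsum 3 (fun t => t) fun t ht => by
      obtain ⟨ht0, htn, htB⟩ := hsmall t ht
      exact hyperProb_hasDenseSet_small_le (a := 1) hp0 hp1 hK0 hK (by omega) (by omega) (by omega)
        hkn ht0 htn (by omega) htB
    have h4 := hsum 4 (fun t => (t + 1) / 2) fun t ht => by
      obtain ⟨ht0, htn, htB⟩ := hsmall t ht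
      exact hyperProb_hasDenseSet_small_le (a := 2) hp0 hp1 hK0 hK (by omega) (by omega) (by omega)
        hkn ht0 htn (by omega) htB
    calc _ ≤ 8 * B / n + 8 * B / n := add_le_add h3 h4
      _ = 16 * B / n := by ring

lemma eventually_mul_div_choose_le_one {k : ℕ} (hk : 2 ≤ k) {K : ℝ} (hK : 0 ≤ K) :
    ∀ᶠ n : ℕ in atTop, K * ((n : ℝ) / n.choose k) ≤ 1 := by
  filter_upwards [eventually_ge_atTop (2 * k),
    eventually_ge_atTop ⌈K * (2 ^ k * (k.factorial : ℝ))⌉₊] with n hn2 hnK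
  have hnK' : K * (2 ^ k * (k.factorial : ℝ)) ≤ n := Nat.ceil_le.1 hnK
  have hn1 : (1 : ℝ) ≤ n := by exact_mod_cast (by omega : 1 ≤ n)
  have hf : (0 : ℝ) < k.factorial := by exact_mod_cast k.factorial_pos
  have hC : (0 : ℝ) < n.choose k := by exact_mod_cast Nat.choose_pos (by omega : k ≤ n)
  have h1 : (((n + 1 - k : ℕ) : ℝ)) ^ k / (k.factorial : ℝ) ≤ n.choose k :=
    Nat.pow_le_choose k n
  have h2 : (n : ℝ) / 2 ≤ ((n + 1 - k : ℕ) : ℝ) := by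
    rw [div_le_iff₀ (by norm_num)]
    exact_mod_cast (by omega : n ≤ (n + 1 - k) * 2)
  have h3 : (n : ℝ) ^ 2 ≤ 2 ^ k * k.factorial * n.choose k := by
    rw [div_le_iff₀ hf] at h1
    calc (n : ℝ) ^ 2 ≤ n ^ k := pow_le_pow_right₀ hn1 hk
      _ = 2 ^ k * (n / 2) ^ k := by rw [← mul_pow]; congr 1; ring
      _ ≤ 2 ^ k * ((n + 1 - k : ℕ) : ℝ) ^ k := by gcongr
      _ ≤ 2 ^ k * (n.choose k * k.factorial) := by gcongr
      _ = _ := by ring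
  rw [mul_div_assoc', div_le_one hC]
  have h4 : K * n * n ≤ n.choose k * n := by
    calc K * n * n = K * n ^ 2 := by ring
      _ ≤ K * (2 ^ k * k.factorial * n.choose k) := by gcongr
      _ = K * (2 ^ k * k.factorial) * n.choose k := by ring
      _ ≤ n * n.choose k := by gcongr
      _ = _ := by ring
  exact le_of_mul_le_mul_right h4 (by linarith)

end HG

/-- There exist an integer `k₀` and a positive constant `c` such
that for any fixed `k ≥ k₀` and fixed `r ≥ 2`: if
`p = p(n) ≤ c (r^(k−1)/k²) n / C(n,k)`, then
`P(H(n,k,p) is r-choosable) → 1` as `n → ∞`. -/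
theorem stmt17 :
    ∃ k₀ : ℕ, ∃ c : ℝ, 0 < c ∧
      ∀ k r : ℕ, k₀ ≤ k → 2 ≤ r → ∀ p : ℕ → ℝ,
        (∀ n, 0 ≤ p n) →
        (∀ n, p n ≤ c * ((r : ℝ) ^ (k - 1) / (k : ℝ) ^ 2) *
            ((n : ℝ) / (n.choose k : ℝ))) →
        Tendsto (fun n => HG.hyperProb n k (p n) (HG.RChoosable r))
          atTop (nhds 1) := by
  refine ⟨20, 1 / 1296, by norm_num, fun k r hk hr p hp0 hp => ?_⟩
  have hr0 : (0 : ℝ) < r := by exact_mod_cast (by omega : 0 < r)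
  have hk0 : (0 : ℝ) < k := by exact_mod_cast (by omega : 0 < k)
  obtain ⟨K, hKdef⟩ : ∃ K : ℝ, K = 1 / 1296 * ((r : ℝ) ^ (k - 1) / (k : ℝ) ^ 2) := ⟨_, rfl⟩
  have hK0 : 0 < K := by rw [hKdef]; positivity
  rw [← hKdef] at hp
  have hB0 : 0 < 54 * (k : ℝ) ^ 4 * K := by positivity
  have hp1 : ∀ᶠ n in atTop, p n ≤ 1 := by
    filter_upwards [HG.eventually_mul_div_choose_le_one (by omega : 2 ≤ k) hK0.le] with n hn
    exact (hp n).trans hn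
  have hlim : Tendsto (fun n : ℕ => 1 - ((1 / 2 : ℝ) ^ ⌊(n : ℝ) / (8 * (54 * k ^ 4 * K))⌋₊
      + 16 * (54 * k ^ 4 * K) / n)) atTop (nhds 1) := by
    have h1 : Tendsto (fun n : ℕ => ⌊(n : ℝ) / (8 * (54 * k ^ 4 * K))⌋₊) atTop atTop :=
      tendsto_nat_floor_atTop.comp
        (tendsto_natCast_atTop_atTop.atTop_div_const (by positivity))
    have h2 := (tendsto_pow_atTop_nhds_zero_of_lt_one (r := (1 / 2 : ℝ)) (by norm_num)
      (by norm_num)).comp h1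
    have h3 := tendsto_const_div_atTop_nhds_zero_nat (16 * (54 * (k : ℝ) ^ 4 * K))
    simpa using (h2.add h3).const_sub 1
  refine tendsto_of_tendsto_of_tendsto_of_le_of_le' hlim tendsto_const_nhds ?_ ?_
  · filter_upwards [hp1, eventually_ge_atTop k,
      eventually_ge_atTop ⌈16 * (54 * (k : ℝ) ^ 4 * K)⌉₊] with n hn1 hkn hnB
    have h1 := HG.hyperProb_not_rChoosable_le_of_large (hp0 n) hn1 hk hr hKdef (hp n) hkn
      (Nat.ceil_le.1 hnB)
    have h2 := HG.hyperProb_add_hyperProb_not n k (p n) (HG.RChoosable r)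
    linarith
  · filter_upwards [hp1] with n hn1
    have h1 := HG.hyperProb_nonneg (n := n) (k := k) (hp0 n) hn1 (fun E => ¬ HG.RChoosable r E)
    have h2 := HG.hyperProb_add_hyperProb_not n k (p n) (HG.RChoosable r)
    linarith
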